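/- Suppose there exists F ∈ 𝓕 with (1/w)(F) < (1/w)(F*). Let d ∈ ℝ satisfy d ≥ [ (c^{j1}(F*) − c^{j1}(F'))/((1/w)(F*) − (1/w)(F')) − (c^{j2}(F*) − c^{j2}(F'''))/((1/w)(F*) − (1/w)(F''')) ] / [ (1/w)(F* ∖ F')/((1/w)(F*) − (1/w)(F')) − (1/w)(F* ∖ F''')/((1/w)(F*) − (1/w)(F''')) ] for all j1, j2 ∈ {1,…,k} and all F', F''' ∈ 𝓕 with (1/w)(F') < (1/w)(F*) < (1/w)(F'''), and define D := max over j ∈ {1,…,k} and F' ∈ 𝓕 with (1/w)(F') < (1/w)(F*) of (c^j(F*) − c^j(F') − d·(1/w)(F* ∖ F'))/((1/w)(F*) − (1/w)(F')). Then for every j ∈ {1,…,k} and every F''' ∈ 𝓕 with (1/w)(F''') > (1/w)(F*): D ≤ (c^j(F*) − c^j(F''') − d·(1/w)(F* ∖ F'''))/((1/w)(F*) − (1/w)(F''')). -/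

import Mathlib

open Finset

noncomputable section

variable {S : Type*}

/-- Sum of a real-valued function over a finite subset: `f(X) = ∑_{s∈X} f(s)`. -/
def costSum (c : S → ℝ) (X : Finset S) : ℝ := ∑ s ∈ X, c s

/-- `(1/w)(X) = ∑_{s∈X} 1/w(s)`. -/
def invw (w : S → ℝ) (X : Finset S) : ℝ := ∑ s ∈ X, 1 / w s

/-- The weighted span `spa_w(p) = max_{s∈S} w(s)p(s) − min_{s∈S} w(s)p(s)`. -/
def spa [Fintype S] [Nonempty S] (w p : S → ℝ) : ℝ :=
  (univ.sup' univ_nonempty fun s => w s * p s) -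
    (univ.inf' univ_nonempty fun s => w s * p s)

/-- A deviation vector `p` is feasible (no bound constraints) for the cost
functions `c^1, …, c^k` if `F*` has minimum `(c^j − p)`-cost in `𝓕` for all `j`. -/
def FeasibleU (𝓕 : Finset (Finset S)) (Fstar : Finset S) {k : ℕ}
    (c : Fin k → S → ℝ) (p : S → ℝ) : Prop :=
  ∀ j : Fin k, ∀ F ∈ 𝓕,
    costSum (fun s => c j s - p s) Fstar ≤ costSum (fun s => c j s - p s) F

lemma invw_nonneg {w : S → ℝ} (hw : ∀ s, 0 < w s) (X : Finset S) : 0 ≤ invw w X :=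
  Finset.sum_nonneg fun s _ => (one_div_pos.mpr (hw s)).le

lemma invw_sdiff_pos [DecidableEq S] {w : S → ℝ} (hw : ∀ s, 0 < w s) {X Y : Finset S}
    (h : invw w Y < invw w X) : 0 < invw w (X \ Y) := by
  refine Finset.sum_pos (fun s _ => one_div_pos.mpr (hw s)) ?_
  rw [Finset.sdiff_nonempty]
  intro hXY
  exact h.not_ge (Finset.sum_le_sum_of_subset_of_nonneg hXY
    fun s _ _ => (one_div_pos.mpr (hw s)).le)

/-- Suppose some `F ∈ 𝓕` has `(1/w)(F) < (1/w)(F*)`, let `d` dominate all the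
two-set ratios, and let `D` be the maximum over `j` and `F' ∈ 𝓕` with
`(1/w)(F') < (1/w)(F*)` of `(c^j(F*) − c^j(F') − d·(1/w)(F* ∖ F')) / ((1/w)(F*) − (1/w)(F'))`.
Then for every `j` and every `F''' ∈ 𝓕` with `(1/w)(F''') > (1/w)(F*)`:
`D ≤ (c^j(F*) − c^j(F''') − d·(1/w)(F* ∖ F''')) / ((1/w)(F*) − (1/w)(F'''))`. -/
theorem stmt12 [Fintype S] [DecidableEq S] [Nonempty S]
    (𝓕 : Finset (Finset S)) (Fstar : Finset S) (hFstar : Fstar ∈ 𝓕)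
    (k : ℕ) (hk : 1 ≤ k) (c : Fin k → S → ℝ)
    (w : S → ℝ) (hw : ∀ s, 0 < w s)
    (F0 : Finset S) (hF0 : F0 ∈ 𝓕) (hF0lt : invw w F0 < invw w Fstar)
    (d : ℝ)
    (hd : ∀ j1 j2 : Fin k, ∀ F' ∈ 𝓕, ∀ F''' ∈ 𝓕,
      invw w F' < invw w Fstar → invw w Fstar < invw w F''' →
      ((costSum (c j1) Fstar - costSum (c j1) F') / (invw w Fstar - invw w F') -
       (costSum (c j2) Fstar - costSum (c j2) F''') /
          (invw w Fstar - invw w F''')) /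
        (invw w (Fstar \ F') / (invw w Fstar - invw w F') -
         invw w (Fstar \ F''') / (invw w Fstar - invw w F''')) ≤ d)
    (D : ℝ)
    (hD : IsGreatest
      {x : ℝ | ∃ j : Fin k, ∃ F' ∈ 𝓕, invw w F' < invw w Fstar ∧
        x = (costSum (c j) Fstar - costSum (c j) F' - d * invw w (Fstar \ F')) /
              (invw w Fstar - invw w F')} D) :
    ∀ j : Fin k, ∀ F''' ∈ 𝓕, invw w Fstar < invw w F''' →
      D ≤ (costSum (c j) Fstar - costSum (c j) F''' - d * invw w (Fstar \ F''')) /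
            (invw w Fstar - invw w F''') := by
  intro j F₃ hF₃ hlt₃
  obtain ⟨⟨i, F₁, hF₁, hlt₁, rfl⟩, -⟩ := hD
  have hpos : 0 < invw w (Fstar \ F₁) / (invw w Fstar - invw w F₁) -
      invw w (Fstar \ F₃) / (invw w Fstar - invw w F₃) := by
    have h₁ := div_pos (invw_sdiff_pos hw hlt₁) (sub_pos.mpr hlt₁)
    have h₃ := div_nonpos_of_nonneg_of_nonpos (invw_nonneg hw (Fstar \ F₃))
      (sub_neg.mpr hlt₃).le
    linarith
  have h := (div_le_iff₀ hpos).mp (hd i j F₁ hF₁ F₃ hF₃ hlt₁ hlt₃)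
  rw [sub_div _ (d * _), sub_div _ (d * _), mul_div_assoc, mul_div_assoc]
  linarith
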